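/- Let p ≥ 2 be an even integer and let α ∈ (1,2) with p > α. Set a = (π⁴/48)^{1/α}. Then for every θ with a ≤ |θ| ≤ π, f^{p,0}(θ) ≤ f^{p,α}(θ). -/

import Mathlib

open MeasureTheory

/-- `sin x / x` with value 1 at 0. -/
noncomputable def sincf (x : ℝ) : ℝ := if x = 0 then 1 else Real.sin x / x

/-- The symbol `f^{p,α}`. -/
noncomputable def fSymbol (p : ℕ) (α : ℝ) (θ : ℝ) : ℝ :=
  ∑' l : ℤ, |θ + 2 * (l : ℝ) * Real.pi| ^ α * sincf (θ / 2 + (l : ℝ) * Real.pi) ^ (p + 1)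

lemma aux_g (q : ℕ) (hq : 3 ≤ q) (α : ℝ) (h2 : α < 2) (u r : ℝ) (hu : 0 < u)
    (hr : 1 ≤ r) (hU : 1 ≤ u ^ α) (h : r ^ 3 - 1 ≤ u ^ α * (r ^ 2 * (r - 1))) :
    ((u * r) ^ α - 1) / (u * r) ^ q ≤ (u ^ α - 1) / u ^ q := by
  have hr0 : 0 < r := by linarith
  rw [Real.mul_rpow hu.le hr0.le, mul_pow]
  have e1 : r ^ α ≤ r ^ 2 := by
    have := Real.rpow_le_rpow_of_exponent_le hr h2.le
    rwa [Real.rpow_two] at this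
  have e2 : r ^ 3 ≤ r ^ q := pow_le_pow_right₀ hr hq
  have huq : 0 < u ^ q := pow_pos hu q
  have hrq : 0 < r ^ q := pow_pos hr0 q
  rw [div_le_div_iff₀ (by positivity) huq]
  have e3 : u ^ α * r ^ α - 1 ≤ (u ^ α - 1) * r ^ q := by
    have a1 : u ^ α * r ^ α ≤ u ^ α * r ^ 2 := mul_le_mul_of_nonneg_left e1 (by linarith)
    have a2 : (u ^ α - 1) * r ^ 3 ≤ (u ^ α - 1) * r ^ q :=
      mul_le_mul_of_nonneg_left e2 (by linarith)
    nlinarith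
  calc (u ^ α * r ^ α - 1) * u ^ q ≤ ((u ^ α - 1) * r ^ q) * u ^ q :=
        mul_le_mul_of_nonneg_right e3 huq.le
    _ = _ := by ring

lemma aux_mono (q : ℕ) (hq : 3 ≤ q) (α : ℝ) (h1 : 1 < α) (h2 : α < 2) (u v : ℝ) (hu : 3 ≤ u)
    (hv : u ≤ v) : (v ^ α - 1) / v ^ q ≤ (u ^ α - 1) / u ^ q := by
  have hu0 : 0 < u := by linarith
  have hU : 3 ≤ u ^ α := by
    have := Real.rpow_le_rpow_of_exponent_le (by linarith : 1 ≤ u) h1.le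
    rw [Real.rpow_one] at this
    linarith
  have hr : 1 ≤ v / u := by rwa [one_le_div hu0]
  have e : v = u * (v / u) := by field_simp
  rw [e]
  apply aux_g q hq α h2 u (v / u) hu0 hr (by linarith)
  set r := v / u
  have : 0 ≤ r ^ 2 * (r - 1) := mul_nonneg (by positivity) (by linarith)
  nlinarith [mul_nonneg (sub_nonneg.2 hr) (sub_nonneg.2 hr),
    mul_nonneg (sub_nonneg.2 hU) this, pow_nonneg (sub_nonneg.2 hr) 3]

lemma aux_first (q : ℕ) (hq : 3 ≤ q) (α : ℝ) (h2 : α < 2) (u v : ℝ) (hu : 0 < u)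
    (hU : 3 / 2 ≤ u ^ α)
    (hv : 3 * u ≤ v) : (v ^ α - 1) / v ^ q ≤ (u ^ α - 1) / u ^ q := by
  have hr : 3 ≤ v / u := by rwa [le_div_iff₀ hu]
  have e : v = u * (v / u) := by field_simp
  rw [e]
  apply aux_g q hq α h2 u (v / u) hu (by linarith) (by linarith)
  set r := v / u
  have : 0 ≤ r ^ 2 * (r - 1) := mul_nonneg (by positivity) (by linarith)
  nlinarith [mul_nonneg (sub_nonneg.2 hU) this, mul_nonneg (sq_nonneg r) (sub_nonneg.2 hr)]

lemma aux_pos (n p : ℕ) (heven : Even p) (θ : ℝ) (h0 : 0 < θ) :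
    sincf (θ / 2 + ((n : ℤ) : ℝ) * Real.pi) ^ (p + 1) =
      (-1) ^ n * ((2 * Real.sin (θ / 2)) ^ (p + 1) / (2 * n * Real.pi + θ) ^ (p + 1)) := by
  have hpi := Real.pi_pos
  have hd : 0 < θ / 2 + (n : ℝ) * Real.pi := by positivity
  have hd2 : 2 * n * Real.pi + θ = 2 * (θ / 2 + (n : ℝ) * Real.pi) := by ring
  have e : ((-1 : ℝ) ^ n) ^ (p + 1) = (-1) ^ n := by
    rw [← pow_mul, mul_comm, pow_mul, (heven.add_one).neg_one_pow]
  push_cast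
  rw [sincf, if_neg hd.ne', Real.sin_add_nat_mul_pi, hd2, ← div_pow,
    mul_div_mul_left _ _ (two_ne_zero), mul_div_assoc, mul_pow, e]

lemma aux_neg (n p : ℕ) (heven : Even p) (θ : ℝ) (h0 : θ ≤ Real.pi) :
    sincf (θ / 2 + ((-((n : ℤ) + 1) : ℤ) : ℝ) * Real.pi) ^ (p + 1) =
      (-1) ^ n * ((2 * Real.sin (θ / 2)) ^ (p + 1) / (2 * (n + 1) * Real.pi - θ) ^ (p + 1)) := by
  have hpi := Real.pi_pos
  have hd : 0 < (n + 1 : ℝ) * Real.pi - θ / 2 := by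
    have : 0 ≤ (n : ℝ) * Real.pi := by positivity
    linarith
  have hd2 : 2 * (n + 1) * Real.pi - θ = 2 * ((n + 1 : ℝ) * Real.pi - θ / 2) := by ring
  have e : ((-1 : ℝ) ^ n) ^ (p + 1) = (-1) ^ n := by
    rw [← pow_mul, mul_comm, pow_mul, (heven.add_one).neg_one_pow]
  have e3 : θ / 2 + ((-((n : ℤ) + 1) : ℤ) : ℝ) * Real.pi = -((n + 1 : ℝ) * Real.pi - θ / 2) := by
    push_cast; ring
  have e4 : Real.sin ((n + 1 : ℝ) * Real.pi - θ / 2) = (-1) ^ n * Real.sin (θ / 2) := by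
    have := Real.sin_nat_mul_pi_sub (θ / 2) (n + 1)
    push_cast at this
    rw [this, pow_succ]; ring
  rw [e3, sincf, if_neg (by linarith), Real.sin_neg, neg_div_neg_eq, e4, hd2, ← div_pow,
    mul_div_mul_left _ _ (two_ne_zero), mul_div_assoc, mul_pow, e]

lemma aux_summable (p : ℕ) (hp : 2 ≤ p) (α : ℝ) (h2 : α < 2) (θ : ℝ)
    (h0 : |θ| ≤ Real.pi) : Summable fun l : ℤ =>
      |θ + 2 * (l : ℝ) * Real.pi| ^ α * sincf (θ / 2 + (l : ℝ) * Real.pi) ^ (p + 1) := by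
  have hpi := Real.pi_pos
  have hp' : (2 : ℝ) ≤ p := by exact_mod_cast hp
  have hs := (Real.summable_abs_int_rpow (b := (p + 1 : ℝ) - α) (by linarith)).mul_left
    ((2 : ℝ) ^ (p + 1) * Real.pi ^ (-((p + 1 : ℝ) - α)))
  refine Summable.of_norm_bounded_eventually hs ?_
  rw [Filter.eventually_cofinite]
  refine (Set.finite_singleton (0 : ℤ)).subset ?_
  intro l hl
  by_contra hne
  apply hl
  have hl1 : (1 : ℝ) ≤ |(l : ℝ)| := by
    have : l ≠ 0 := hne
    exact_mod_cast Int.one_le_abs this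
  set x := θ + 2 * (l : ℝ) * Real.pi with hx
  have hxl : Real.pi * |(l : ℝ)| ≤ |x| := by
    have a : |2 * (l : ℝ) * Real.pi| = 2 * |(l : ℝ)| * Real.pi := by
      rw [abs_mul, abs_mul, abs_of_pos hpi, abs_two]
    have b : |2 * (l : ℝ) * Real.pi| ≤ |x| + |θ| := by
      have : 2 * (l : ℝ) * Real.pi = x - θ := by rw [hx]; ring
      rw [this]; exact abs_sub _ _
    nlinarith
  have hx0 : 0 < |x| := by nlinarith
  have hx2 : θ / 2 + (l : ℝ) * Real.pi = x / 2 := by rw [hx]; ring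
  have hxn : x / 2 ≠ 0 := by
    have := abs_pos.1 hx0
    simpa using this
  rw [hx2, sincf, if_neg hxn, norm_mul, norm_pow, Real.norm_eq_abs, Real.norm_eq_abs,
    abs_of_pos (Real.rpow_pos_of_pos hx0 α), abs_div, abs_div, abs_two]
  have k1 : (|Real.sin (x / 2)| / (|x| / 2)) ^ (p + 1) ≤ (2 / |x|) ^ (p + 1) := by
    apply pow_le_pow_left₀ (by positivity)
    rw [div_le_div_iff₀ (by positivity) hx0]
    have := Real.abs_sin_le_one (x / 2)
    nlinarith
  have k2 : |x| ^ α * (2 / |x|) ^ (p + 1) = 2 ^ (p + 1) * |x| ^ (-((p + 1 : ℝ) - α)) := by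
    have : -((p + 1 : ℝ) - α) = α - ((p + 1 : ℕ) : ℝ) := by push_cast; ring
    rw [this, Real.rpow_sub hx0, Real.rpow_natCast, div_pow]
    ring
  have k3 : |x| ^ (-((p + 1 : ℝ) - α)) ≤ (Real.pi * |(l : ℝ)|) ^ (-((p + 1 : ℝ) - α)) :=
    Real.rpow_le_rpow_of_nonpos (by positivity) hxl (by linarith)
  rw [Real.mul_rpow hpi.le (abs_nonneg _)] at k3
  calc _ ≤ |x| ^ α * (2 / |x|) ^ (p + 1) := mul_le_mul_of_nonneg_left k1 (by positivity)
    _ = _ := k2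
    _ ≤ _ := by
      rw [mul_assoc]
      exact mul_le_mul_of_nonneg_left k3 (by positivity)

lemma aux_even (p : ℕ) (α θ : ℝ) : fSymbol p α (-θ) = fSymbol p α θ := by
  unfold fSymbol
  rw [← (Equiv.neg ℤ).tsum_eq]
  refine tsum_congr fun l => ?_
  have hs : ∀ x, sincf (-x) = sincf x := by
    intro x; simp [sincf, neg_div_neg_eq]
  have e1 : -θ + 2 * (((Equiv.neg ℤ) l : ℤ) : ℝ) * Real.pi = -(θ + 2 * (l : ℝ) * Real.pi) := by
    simp; ring
  have e2 : -θ / 2 + (((Equiv.neg ℤ) l : ℤ) : ℝ) * Real.pi = -(θ / 2 + (l : ℝ) * Real.pi) := by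
    simp; ring
  rw [e1, e2, hs, abs_neg]

set_option maxHeartbeats 2000000 in
lemma aux_main (p : ℕ) (hp : 2 ≤ p) (heven : Even p) (α : ℝ) (h1 : 1 < α) (h2 : α < 2)
    (θ : ℝ) (h0 : 0 < θ) (hU : 3 / 2 ≤ θ ^ α) (hθ : θ ≤ Real.pi) :
    fSymbol p 0 θ ≤ fSymbol p α θ := by
  have hpi := Real.pi_pos
  have hpi3 := Real.pi_gt_three
  have habs : |θ| ≤ Real.pi := by rwa [abs_of_pos h0]
  have s0 := aux_summable p hp 0 (by norm_num) θ habs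
  have s1 := aux_summable p hp α h2 θ habs
  rw [← sub_nonneg]
  unfold fSymbol
  rw [← s1.tsum_sub s0]
  have sd := s1.sub s0
  set S : ℝ := (2 * Real.sin (θ / 2)) ^ (p + 1) with hS
  have hS0 : 0 ≤ S := by
    have := Real.sin_nonneg_of_nonneg_of_le_pi (x := θ / 2) (by linarith) (by linarith)
    positivity
  set D : ℤ → ℝ := fun l =>
    |θ + 2 * (l : ℝ) * Real.pi| ^ α * sincf (θ / 2 + (l : ℝ) * Real.pi) ^ (p + 1) -
    |θ + 2 * (l : ℝ) * Real.pi| ^ (0 : ℝ) * sincf (θ / 2 + (l : ℝ) * Real.pi) ^ (p + 1) with hD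
  let g : ℝ → ℝ := fun u => (u ^ α - 1) / u ^ (p + 1)
  have dpos : ∀ n : ℕ, D n = (-1) ^ n * (S * g (2 * n * Real.pi + θ)) := by
    intro n
    simp only [hD, Real.rpow_zero]
    rw [aux_pos n p heven θ h0]
    have : |θ + 2 * ((n : ℤ) : ℝ) * Real.pi| = 2 * n * Real.pi + θ := by
      push_cast
      rw [abs_of_pos (by positivity)]; ring
    rw [this]
    simp only [g]
    ring
  have dneg : ∀ n : ℕ, D (-((n : ℤ) + 1)) = (-1) ^ n * (S * g (2 * (n + 1) * Real.pi - θ)) := by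
    intro n
    simp only [hD, Real.rpow_zero]
    rw [aux_neg n p heven θ hθ]
    have : |θ + 2 * ((-((n : ℤ) + 1) : ℤ) : ℝ) * Real.pi| = 2 * (n + 1) * Real.pi - θ := by
      push_cast
      have : 0 ≤ (n : ℝ) * Real.pi := by positivity
      rw [abs_of_neg (by nlinarith)]; ring
    rw [this]
    simp only [g]
    ring
  clear_value D S
  have sp : Summable fun n : ℕ => D n := sd.comp_injective Nat.cast_injective
  have sn : Summable fun n : ℕ => D (-((n : ℤ) + 1)) :=
    sd.comp_injective (i := fun n : ℕ => (-((n : ℤ) + 1))) (by intro a b h; simpa using h)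
  rw [tsum_of_nat_of_neg_add_one sp sn, ← sp.tsum_add sn]
  have sh := sp.add sn
  have i1 : Function.Injective fun k : ℕ => 2 * k := by intro a b h; simpa using h
  have i2 : Function.Injective fun k : ℕ => 2 * k + 1 := by intro a b h; simpa using h
  have t1 : Summable fun k : ℕ => (D ((2 * k : ℕ) : ℤ) + D (-(((2 * k : ℕ) : ℤ) + 1))) :=
    sh.comp_injective i1
  have t2 : Summable fun k : ℕ => (D ((2 * k + 1 : ℕ) : ℤ) + D (-(((2 * k + 1 : ℕ) : ℤ) + 1))) :=
    sh.comp_injective i2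
  rw [← tsum_even_add_odd (f := fun n : ℕ => D n + D (-((n : ℤ) + 1))) t1 t2, ← t1.tsum_add t2]
  refine tsum_nonneg fun k => ?_
  rw [dpos, dpos, dneg, dneg]
  have hk : 0 ≤ (k : ℝ) * Real.pi := by positivity
  have eq1 : (-1 : ℝ) ^ (2 * k) = 1 := by simp
  have eq2 : (-1 : ℝ) ^ (2 * k + 1) = -1 := by rw [pow_succ, eq1]; ring
  rw [eq1, eq2]
  push_cast
  have m1 : g (2 * (2 * k + 1) * Real.pi + θ) ≤ g (2 * (2 * k + 1) * Real.pi - θ) :=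
    aux_mono (p + 1) (by omega) α h1 h2 _ _ (by nlinarith) (by linarith)
  have m2 : g (2 * (2 * k + 1 + 1) * Real.pi - θ) ≤ g (2 * (2 * k) * Real.pi + θ) := by
    rcases Nat.eq_zero_or_pos k with rfl | hkp
    · apply aux_first (p + 1) (by omega) α h2
      · simpa using h0
      · simpa using hU
      · push_cast; linarith
    · have : (1 : ℝ) ≤ k := by exact_mod_cast hkp
      exact aux_mono (p + 1) (by omega) α h1 h2 _ _ (by nlinarith) (by nlinarith)
  have := mul_le_mul_of_nonneg_left m1 hS0
  have := mul_le_mul_of_nonneg_left m2 hS0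
  linarith

theorem stmt11 (p : ℕ) (hp : 2 ≤ p) (heven : Even p) (α : ℝ) (h1 : 1 < α) (h2 : α < 2)
    (hpα : α < p) :
    ∀ θ : ℝ, (Real.pi ^ 4 / 48) ^ (1 / α) ≤ |θ| → |θ| ≤ Real.pi →
      fSymbol p 0 θ ≤ fSymbol p α θ := by
  intro θ ha hb
  have hpi3 := Real.pi_gt_three
  have h4 : (3 : ℝ) / 2 ≤ Real.pi ^ 4 / 48 := by
    have : (3 : ℝ) ^ 4 ≤ Real.pi ^ 4 := pow_le_pow_left₀ (by norm_num) hpi3.le 4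
    linarith
  have hpos : 0 < |θ| := lt_of_lt_of_le (Real.rpow_pos_of_pos (by linarith) _) ha
  have hU : 3 / 2 ≤ |θ| ^ α := by
    have := Real.rpow_le_rpow (Real.rpow_nonneg (by linarith) _) ha (by linarith : 0 ≤ α)
    rw [← Real.rpow_mul (by linarith), one_div, inv_mul_cancel₀ (by linarith), Real.rpow_one] at this
    linarith
  have key := aux_main p hp heven α h1 h2 |θ| hpos hU hb
  rcases abs_choice θ with h | h
  · rwa [h] at key
  · rwa [h, aux_even, aux_even] at key
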